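/- The matrix P = (1/√3)·[[1, ξ, 1], [1, 1, ξ], [ξ, 1, 1]] is unitary and satisfies P A P⁻¹ = A and P B P⁻¹ = A² B. -/

import Mathlib

open Matrix

noncomputable section

/-- `ξ = exp(2πi/3)`, a primitive cube root of unity. -/
def ξ : ℂ := Complex.exp (2 * Real.pi * Complex.I / 3)

/-- The cyclic permutation matrix `A`, with rows `(0,1,0)`, `(0,0,1)`, `(1,0,0)`. -/
def A : Matrix (Fin 3) (Fin 3) ℂ := !![0, 1, 0; 0, 0, 1; 1, 0, 0]

/-- The diagonal matrix `B = diag(1, ξ, ξ²)`. -/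
def B : Matrix (Fin 3) (Fin 3) ℂ := !![1, 0, 0; 0, ξ, 0; 0, 0, ξ ^ 2]

/-- The matrix `P = (1/√3)·[[1,ξ,1],[1,1,ξ],[ξ,1,1]]`. -/
def P : Matrix (Fin 3) (Fin 3) ℂ :=
  (((Real.sqrt 3 : ℝ) : ℂ))⁻¹ • !![1, ξ, 1; 1, 1, ξ; ξ, 1, 1]

lemma isPrimitiveRoot_ξ : IsPrimitiveRoot ξ 3 := by
  simpa [ξ] using Complex.isPrimitiveRoot_exp 3 (by norm_num)

lemma ξ_pow_three : ξ ^ 3 = 1 := isPrimitiveRoot_ξ.pow_eq_one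

lemma one_add_ξ_add_ξ_sq : 1 + ξ + ξ ^ 2 = 0 := by
  simpa [Finset.sum_range_succ] using isPrimitiveRoot_ξ.geom_sum_eq_zero (by norm_num)

lemma conj_ξ : starRingEnd ℂ ξ = ξ ^ 2 := by
  have h : starRingEnd ℂ ξ = ξ⁻¹ :=
    (Complex.inv_eq_conj (isPrimitiveRoot_ξ.norm'_eq_one (by norm_num))).symm
  rw [h]
  exact inv_eq_of_mul_eq_one_right (by linear_combination ξ_pow_three)

lemma ofReal_sqrt_three_inv_sq : ((Real.sqrt 3 : ℝ) : ℂ)⁻¹ ^ 2 = 1 / 3 := by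
  rw [inv_pow, ← Complex.ofReal_pow, Real.sq_sqrt (by norm_num)]
  norm_num

lemma P_mem_unitaryGroup : P ∈ Matrix.unitaryGroup (Fin 3) ℂ := by
  have hc : star ((Real.sqrt 3 : ℝ) : ℂ)⁻¹ = ((Real.sqrt 3 : ℝ) : ℂ)⁻¹ := by simp
  have hM : (!![1, ξ, 1; 1, 1, ξ; ξ, 1, 1] : Matrix (Fin 3) (Fin 3) ℂ) *
      star !![1, ξ, 1; 1, 1, ξ; ξ, 1, 1] = (3 : ℂ) • 1 := by
    have h3 := ξ_pow_three
    have h0 := one_add_ξ_add_ξ_sq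
    ext i j
    fin_cases i <;> fin_cases j <;>
      simp [Matrix.mul_apply, Fin.sum_univ_three, Matrix.star_apply, conj_ξ] <;>
      grind
  rw [Matrix.mem_unitaryGroup_iff, P, star_smul, hc, smul_mul_smul_comm, hM, smul_smul, ← sq,
    ofReal_sqrt_three_inv_sq]
  norm_num

lemma P_mul_A : P * A = A * P := by
  rw [P, Matrix.smul_mul, Matrix.mul_smul]
  congr 1
  ext i j
  fin_cases i <;> fin_cases j <;> simp [A, Matrix.mul_apply, Fin.sum_univ_three]

lemma P_mul_B : P * B = A ^ 2 * B * P := by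
  rw [P, Matrix.smul_mul, Matrix.mul_smul]
  congr 1
  have h3 := ξ_pow_three
  ext i j
  fin_cases i <;> fin_cases j <;>
    simp [A, B, sq, Matrix.mul_apply, Fin.sum_univ_three] <;> grind

/-- `P` is unitary, commutes with `A`, and conjugates `B` to `A²B`. -/
theorem P_unitary_and_conjugation :
    P ∈ Matrix.unitaryGroup (Fin 3) ℂ ∧ P * A * P⁻¹ = A ∧ P * B * P⁻¹ = A ^ 2 * B := by
  have hP : IsUnit P.det := (Matrix.isUnit_iff_isUnit_det P).mp
    (IsUnit.of_mul_eq_one _ (Matrix.mem_unitaryGroup_iff.mp P_mem_unitaryGroup))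
  refine ⟨P_mem_unitaryGroup, ?_, ?_⟩
  · rw [P_mul_A, Matrix.mul_nonsing_inv_cancel_right _ _ hP]
  · rw [P_mul_B, Matrix.mul_nonsing_inv_cancel_right _ _ hP]
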